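/- Rokhlin formula for transition probability kernels: Let T be a forward expansive correspondence on a compact metric space (X,d), Q a transition probability kernel on X supported by T, μ a Q-invariant Borel probability measure on X, and R a backward conditional transition probability kernel of μQ^{[1]} from X to X supported on O₂(T). Then h_μ(Q) = ∫_X H(R_x) dμ(x). -/

import Mathlib

open Filter MeasureTheory Set
open scoped Topology ENNReal Classical

namespace Corr

variable {X : Type*}

/-- `T` is a correspondence on `X`: each `T x` is a nonempty closed subset of `X`
and the graph `O₂(T)` is closed in `X × X`. -/
def IsCorrespondence [MetricSpace X] (T : X → Set X) : Prop :=
  (∀ x, (T x).Nonempty) ∧ (∀ x, IsClosed (T x)) ∧ IsClosed {p : X × X | p.2 ∈ T p.1}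

/-- The graph `O₂(T) = {(x₁,x₂) : x₂ ∈ T x₁}`. -/
def graph2 (T : X → Set X) : Set (X × X) := {p | p.2 ∈ T p.1}

/-- The orbit space `O_ω(T)` (0-indexed sequences). -/
def orbitSpace (T : X → Set X) : Set (ℕ → X) := {x | ∀ k, x (k + 1) ∈ T (x k)}

/-- `x : Fin (n+1) → X` is an element of `O_{n+1}(T)`. -/
def IsFinOrbit (T : X → Set X) {n : ℕ} (x : Fin (n + 1) → X) : Prop :=
  ∀ i : Fin n, x i.succ ∈ T (x i.castSucc)

/-- `O_{n+1}(T)` as a subset of `Fin (n+1) → X` (with the sup metric). -/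
def finOrbits (T : X → Set X) (n : ℕ) : Set (Fin (n + 1) → X) := {x | IsFinOrbit T x}

/-- The first `n` entries of `x : ℕ → X` form an orbit in `O_n(T)`. -/
def IsOrbitSeg (T : X → Set X) (n : ℕ) (x : ℕ → X) : Prop :=
  ∀ i : ℕ, i + 1 < n → x (i + 1) ∈ T (x i)

/-- The shift on sequences. -/
def shiftSeq : (ℕ → X) → ℕ → X := fun x k => x (k + 1)

/-- The shift `σ` on the orbit space `O_ω(T)`. -/
def shiftOrb (T : X → Set X) : ↥(orbitSpace T) → ↥(orbitSpace T) :=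
  fun x => ⟨shiftSeq x.1, fun k => x.2 (k + 1)⟩

/-- The metric `d_ω` on sequences (`k`-th coordinate, `k ≥ 0`, has weight `2^{-(k+1)}`). -/
noncomputable def dOmega [MetricSpace X] (x y : ℕ → X) : ℝ :=
  ∑' k : ℕ, (1 / 2 : ℝ) ^ (k + 1) * (dist (x k) (y k) / (1 + dist (x k) (y k)))

/-- `T` is forward expansive with expansive constant `ε`. -/
def IsFwdExpansiveWith [MetricSpace X] (T : X → Set X) (ε : ℝ) : Prop :=
  0 < ε ∧ ∀ x ∈ orbitSpace T, ∀ y ∈ orbitSpace T, x ≠ y → ∃ n : ℕ, ε < dist (x n) (y n)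

/-- `T` is forward expansive. -/
def IsFwdExpansive [MetricSpace X] (T : X → Set X) : Prop :=
  ∃ ε : ℝ, IsFwdExpansiveWith T ε

/-- Extension by `0` of a potential `φ : O₂(T) → ℝ` to `X × X`. -/
noncomputable def ext2 (T : X → Set X) (φ : ↥(graph2 T) → ℝ) : X × X → ℝ :=
  fun p => if h : p ∈ graph2 T then φ ⟨p, h⟩ else 0

/-- The Birkhoff sum `S_n φ` along an element of `X^{n+1}` (equal to the sum
`∑_{i=1}^n φ(x_i, x_{i+1})` on orbits in `O_{n+1}(T)`). -/
noncomputable def birkhoff (T : X → Set X) (φ : ↥(graph2 T) → ℝ) {n : ℕ}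
    (x : Fin (n + 1) → X) : ℝ :=
  ∑ i : Fin n, ext2 T φ (x i.castSucc, x i.succ)

/-- `E` is `ε`-separated: distinct points of `E` are at distance `≥ ε`. -/
def eSep {Y : Type*} [PseudoMetricSpace Y] (ε : ℝ) (E : Set Y) : Prop :=
  ∀ x ∈ E, ∀ y ∈ E, x ≠ y → ε ≤ dist x y

/-- `∑_{x ∈ E} exp (S_n φ (x))` for a set `E` of orbit segments. -/
noncomputable def orbSum (T : X → Set X) (φ : ↥(graph2 T) → ℝ) (n : ℕ)
    (E : Set (Fin (n + 1) → X)) : ℝ≥0∞ :=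
  ∑' x : E, ENNReal.ofReal (Real.exp (birkhoff T φ (x : Fin (n + 1) → X)))

/-- Logarithm `ℝ≥0∞ → EReal`, with `log 0 = ⊥` and `log ⊤ = ⊤`. -/
noncomputable def elog (x : ℝ≥0∞) : EReal :=
  if x = 0 then ⊥ else if x = ⊤ then ⊤ else ((Real.log x.toReal : ℝ) : EReal)

/-- `sup_E ∑_{x ∈ E} exp (S_n φ (x))` over `ε`-separated subsets `E` of `O_{n+1}(T)`. -/
noncomputable def sepSup [MetricSpace X] (T : X → Set X) (φ : ↥(graph2 T) → ℝ)
    (n : ℕ) (ε : ℝ) : ℝ≥0∞ :=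
  ⨆ (E : Set (Fin (n + 1) → X)) (_ : E ⊆ finOrbits T n) (_ : eSep ε E), orbSum T φ n E

/-- `inf_F ∑_{x ∈ F} exp (S_n φ (x))` over `ε`-spanning subsets `F` of `O_{n+1}(T)`. -/
noncomputable def spanInf [MetricSpace X] (T : X → Set X) (φ : ↥(graph2 T) → ℝ)
    (n : ℕ) (ε : ℝ) : ℝ≥0∞ :=
  ⨅ (E : Set (Fin (n + 1) → X)) (_ : E ⊆ finOrbits T n)
    (_ : ∀ y ∈ finOrbits T n, ∃ x ∈ E, dist x y < ε), orbSum T φ n E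

/-- `limsup_n (1/n) log sup_E ∑_{x ∈ E} exp (S_n φ (x))` for a fixed `ε`. -/
noncomputable def pressSepEps [MetricSpace X] (T : X → Set X) (φ : ↥(graph2 T) → ℝ)
    (ε : ℝ) : EReal :=
  Filter.limsup (fun n : ℕ => (((n : ℝ)⁻¹ : ℝ) : EReal) * elog (sepSup T φ n ε)) atTop

/-- The spanning-set analogue of `pressSepEps`. -/
noncomputable def pressSpanEps [MetricSpace X] (T : X → Set X) (φ : ↥(graph2 T) → ℝ)
    (ε : ℝ) : EReal :=
  Filter.limsup (fun n : ℕ => (((n : ℝ)⁻¹ : ℝ) : EReal) * elog (spanInf T φ n ε)) atTop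

/-- The topological pressure `P(T,φ)` of a correspondence: the limit as `ε → 0⁺`
(equivalently, since `pressSepEps` is antitone in `ε`, the limsup) of
`limsup_n (1/n) log sup_E ∑_{x∈E} exp (S_nφ(x))` over `ε`-separated sets `E ⊆ O_{n+1}(T)`. -/
noncomputable def pressure [MetricSpace X] (T : X → Set X) (φ : ↥(graph2 T) → ℝ) : EReal :=
  Filter.limsup (fun ε : ℝ => pressSepEps T φ ε) (𝓝[>] (0 : ℝ))

section MeasureTheoryDefs

variable [MeasurableSpace X]

/-- A transition probability kernel on `X`: a measurable assignment of probability
measures. -/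
def IsTransKernel (Q : X → Measure X) : Prop :=
  Measurable Q ∧ ∀ x, IsProbabilityMeasure (Q x)

/-- The kernel `Q` is supported by the correspondence `T`. -/
def SupportedBy (T : X → Set X) (Q : X → Measure X) : Prop :=
  ∀ x, Q x (T x) = 1

/-- `markovLaw μ Q n = μQ^{[n]}`, the law on `X^{n+1}` of the first `n+1` states of the
Markov chain with initial law `μ` and transition kernel `Q`. -/
noncomputable def markovLaw (μ : Measure X) (Q : X → Measure X) :
    (n : ℕ) → Measure (Fin (n + 1) → X)
  | 0 => μ.map fun x => fun _ : Fin 1 => x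
  | n + 1 => (markovLaw μ Q n).bind fun x => (Q (x (Fin.last n))).map fun y => Fin.snoc x y

/-- `μQ^{[1]}` as a measure on `X × X`. -/
noncomputable def step2 (μ : Measure X) (Q : X → Measure X) : Measure (X × X) :=
  μ.bind fun x => (Q x).map fun y => (x, y)

/-- `ν` is the law `μQ^ω` on `X^ℕ` of the full trajectory of the Markov chain with
initial law `μ` and transition kernel `Q`. -/
def IsTrajLaw (μ : Measure X) (Q : X → Measure X) (ν : Measure (ℕ → X)) : Prop :=
  IsProbabilityMeasure ν ∧
    ∀ n : ℕ, ν.map (fun x (i : Fin (n + 1)) => x i.val) = markovLaw μ Q n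

end MeasureTheoryDefs

/-- The entropy `H_ν(𝒜)` of the finite measurable partition of `Y` given by the fibers
of `p : Y → I`. -/
noncomputable def partEntropy {Y : Type*} [MeasurableSpace Y] (ν : Measure Y)
    {I : Type*} [Fintype I] (p : Y → I) : ℝ :=
  ∑ i : I, Real.negMulLog ((ν (p ⁻¹' {i})).toReal)

/-- The measure-theoretic entropy `h_μ(Q)` of a transition probability kernel:
`sup_𝒜 lim_n (1/n) H_{μQ^{[n-1]}}(𝒜ⁿ)` over finite measurable partitions `𝒜` of `X`. -/
noncomputable def kernelEntropy [MeasurableSpace X] (μ : Measure X) (Q : X → Measure X) :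
    EReal :=
  ⨆ (m : ℕ) (p : X → Fin m) (_ : Measurable p),
    ((Filter.limsup
        (fun n : ℕ => (n : ℝ)⁻¹ * partEntropy (markovLaw μ Q (n - 1)) fun x => p ∘ x)
        atTop : ℝ) : EReal)

/-- The Kolmogorov–Sinai entropy `h_ν(g)` of a measurable map `g`:
`sup_𝒫 lim_n (1/n) H_ν(⋁_{i<n} g^{-i}𝒫)` over finite measurable partitions `𝒫`. -/
noncomputable def ksEntropy {Y : Type*} [MeasurableSpace Y] (ν : Measure Y) (g : Y → Y) :
    EReal :=
  ⨆ (m : ℕ) (p : Y → Fin m) (_ : Measurable p),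
    ((Filter.limsup
        (fun n : ℕ => (n : ℝ)⁻¹ * partEntropy ν fun y => fun i : Fin n => p (g^[i.val] y))
        atTop : ℝ) : EReal)

/-- The energy term `∫_X ∫_{T(x)} φ(x,y) dQ_x(y) dμ(x)`. -/
noncomputable def energyInt [MeasurableSpace X] (T : X → Set X) (φ : ↥(graph2 T) → ℝ)
    (Q : X → Measure X) (μ : Measure X) : ℝ :=
  ∫ x, (∫ y in T x, ext2 T φ (x, y) ∂(Q x)) ∂μ

/-- `sup_{Q,μ} { h_μ(Q) + ∫∫ φ dQ dμ }` over transition probability kernels `Q`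
supported by `T` and `Q`-invariant Borel probability measures `μ`. -/
noncomputable def varSup [MetricSpace X] [MeasurableSpace X] (T : X → Set X)
    (φ : ↥(graph2 T) → ℝ) : EReal :=
  ⨆ (Q : X → Measure X) (_ : IsTransKernel Q) (_ : SupportedBy T Q) (μ : Measure X)
    (_ : IsProbabilityMeasure μ) (_ : μ.bind Q = μ),
    kernelEntropy μ Q + ((energyInt T φ Q μ : ℝ) : EReal)

/-- `(μ, Q)` is an equilibrium state for `T` and `φ`. -/
def IsEquilibrium [MetricSpace X] [MeasurableSpace X] (T : X → Set X) (φ : ↥(graph2 T) → ℝ)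
    (μ : Measure X) (Q : X → Measure X) : Prop :=
  IsTransKernel Q ∧ SupportedBy T Q ∧ IsProbabilityMeasure μ ∧ μ.bind Q = μ ∧
    pressure T φ = kernelEntropy μ Q + ((energyInt T φ Q μ : ℝ) : EReal)

/-- `H(ρ) = -∑_y ρ{y} log ρ{y}` if `ρ` is supported on a countable set, `∞` otherwise. -/
noncomputable def atomEntropy {Y : Type*} [MeasurableSpace Y] (ρ : Measure Y) : ℝ≥0∞ :=
  if ∃ A : Set Y, A.Countable ∧ MeasurableSet A ∧ ρ A = 1 then
    ∑' y : Y, ENNReal.ofReal (Real.negMulLog ((ρ {y}).toReal))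
  else ⊤

/-- `R` is a backward conditional transition probability kernel of `ν` from `X₂` to `X₁`
supported on `M`. -/
def IsBackwardCondKernel {X₁ X₂ : Type*} [MeasurableSpace X₁] [MeasurableSpace X₂]
    (ν : Measure (X₁ × X₂)) (M : Set (X₁ × X₂)) (R : X₂ → Measure X₁) : Prop :=
  Measurable R ∧ (∀ x, IsProbabilityMeasure (R x)) ∧
    (∀ x₂ ∈ Prod.snd '' M, R x₂ {x₁ | (x₁, x₂) ∈ M} = 1) ∧
    ∀ C : Set (X₁ × X₂), MeasurableSet C →
      ν C = ∫⁻ x₂, R x₂ {x₁ | (x₁, x₂) ∈ C} ∂(ν.map Prod.snd)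

/-- `m(k) = ∑_{l<k} (m_l + p_l)`, the offsets in the specification property. -/
def specShift {n : ℕ} (m p : Fin n → ℕ) (k : ℕ) : ℕ :=
  ∑ l : Fin n, if l.val < k then m l + p l else 0

/-- The specification property for correspondences. -/
def HasSpecification [MetricSpace X] (T : X → Set X) : Prop :=
  ∀ ε : ℝ, 0 < ε → ∃ M : ℕ, ∀ (n : ℕ) (m p : Fin n → ℕ) (x : Fin n → ℕ → X),
    (∀ j, 1 ≤ m j) → (∀ j, M < p j) → (∀ j, IsOrbitSeg T (m j) (x j)) →
    ∃ z ∈ orbitSpace T, ∀ j : Fin n, ∀ i < m j,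
      dist (z (specShift m p j.val + i)) (x j i) < ε

/-- `φ` is Bowen summable w.r.t. the expansive constant `ε`, i.e.
`sup_n K_{φ,T}(ε,n) < ∞`. -/
def BowenSummableWith [MetricSpace X] (T : X → Set X) (φ : ↥(graph2 T) → ℝ) (ε : ℝ) : Prop :=
  ∃ C : ℝ, ∀ (n : ℕ) (x y : Fin (n + 1) → X), IsFinOrbit T x → IsFinOrbit T y →
    (∀ k, dist (x k) (y k) < ε) → |birkhoff T φ x - birkhoff T φ y| ≤ C

/-- Forward image `T(A) = ⋃_{x ∈ A} T(x)`. -/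
def corrImage (T : X → Set X) (A : Set X) : Set X := ⋃ x ∈ A, T x

/-- Iterated forward images `Tⁿ(A)`. -/
def corrIter (T : X → Set X) : ℕ → Set X → Set X
  | 0, A => A
  | n + 1, A => corrImage T (corrIter T n A)

/-- Backward image `T^{-1}(A) = {y : A ∩ T(y) ≠ ∅}`. -/
def corrPre (T : X → Set X) (A : Set X) : Set X := {y | (A ∩ T y).Nonempty}

/-- Iterated backward images `T^{-n}(A)`. -/
def corrPreIter (T : X → Set X) : ℕ → Set X → Set X
  | 0, A => A
  | n + 1, A => corrPre T (corrPreIter T n A)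

/-- `T` is an open correspondence. -/
def IsOpenCorr [MetricSpace X] (T : X → Set X) : Prop :=
  ∀ U : Set X, IsOpen U → IsOpen (corrImage T U)

/-- `T` is strongly transitive: `⋃_{n ≥ 1} T^{-n}(x)` is dense for every `x`. -/
def StronglyTransitive [MetricSpace X] (T : X → Set X) : Prop :=
  ∀ x : X, Dense (⋃ n : ℕ, corrPreIter T (n + 1) {x})

/-- `T` is distance-expanding. -/
def DistanceExpanding [MetricSpace X] (T : X → Set X) : Prop :=
  ∃ lam : ℝ, 1 < lam ∧ ∃ η : ℝ, 0 < η ∧ ∃ n : ℕ, 1 ≤ n ∧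
    ∀ x y : X, dist x y ≤ η →
      ∀ x' ∈ corrIter T n {x}, ∀ y' ∈ corrIter T n {y}, lam * dist x y ≤ dist x' y'

/-- `T` is topologically exact. -/
def TopologicallyExact [MetricSpace X] (T : X → Set X) : Prop :=
  ∀ U : Set X, IsOpen U → U.Nonempty → ∃ N : ℕ, 1 ≤ N ∧ corrIter T N U = Set.univ

/-- `φ : O₂(T) → ℝ` is Hölder continuous w.r.t. the metric
`d₂((x₁,x₂),(y₁,y₂)) = max (d x₁ y₁) (d x₂ y₂)` (the product metric on `X × X`). -/
def HolderOn [MetricSpace X] (T : X → Set X) (φ : ↥(graph2 T) → ℝ) : Prop :=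
  ∃ C : ℝ, 0 < C ∧ ∃ α : ℝ, 0 < α ∧ α ≤ 1 ∧
    ∀ a b : ↥(graph2 T), |φ a - φ b| ≤ C * dist (a : X × X) (b : X × X) ^ α

/-- `O_{-n}(x)`: backward orbits of length `n+1` terminating at `x`. -/
def backOrbits (T : X → Set X) (n : ℕ) (x : X) : Set (Fin (n + 1) → X) :=
  {y | IsFinOrbit T y ∧ y (Fin.last n) = x}

/-- The lift `φ̃(x₁,x₂,…) = φ(x₁,x₂)` of a potential to the orbit space. -/
def liftPhi (T : X → Set X) (φ : ↥(graph2 T) → ℝ) : ↥(orbitSpace T) → ℝ :=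
  fun x => φ ⟨(x.1 0, x.1 1), x.2 0⟩

/-- The Ruelle operator `L_{φ̃}` for the shift on the orbit space:
`(L_{φ̃} Φ)(x) = ∑_{σ(y)=x} Φ(y) exp(φ̃(y))`. -/
noncomputable def ruelleL (T : X → Set X) (φ : ↥(graph2 T) → ℝ)
    (Φ : ↥(orbitSpace T) → ℝ) : ↥(orbitSpace T) → ℝ :=
  fun x => ∑ᶠ (y : ↥(orbitSpace T)) (_ : shiftOrb T y = x), Φ y * Real.exp (liftPhi T φ y)

/-- Classical topological pressure of a map `g : Y → Y` w.r.t. a potential `ψ` and an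
explicit distance function `ρ`, via `(n,ε)`-separated sets. -/
noncomputable def dynPressure {Y : Type*} (ρ : Y → Y → ℝ) (g : Y → Y) (ψ : Y → ℝ) : EReal :=
  Filter.limsup (fun ε : ℝ =>
    Filter.limsup (fun n : ℕ => (((n : ℝ)⁻¹ : ℝ) : EReal) * elog
      (⨆ (E : Set Y) (_ : ∀ x ∈ E, ∀ y ∈ E, x ≠ y → ∃ j < n, ε ≤ ρ (g^[j] x) (g^[j] y)),
        ∑' x : E, ENNReal.ofReal (Real.exp (∑ j ∈ Finset.range n, ψ (g^[j] (x : Y))))))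
      atTop) (𝓝[>] (0 : ℝ))

end Corr
namespace Corr

/-- Pushing forward a measurable family of probability measures along a jointly measurable map
yields a measurable family of measures. -/
lemma measurable_map_prodMk {α β γ : Type*} [MeasurableSpace α] [MeasurableSpace β]
    [MeasurableSpace γ] {κ : α → Measure β} (hκ : Measurable κ)
    (hp : ∀ a, IsProbabilityMeasure (κ a)) {f : α × β → γ} (hf : Measurable f) :
    Measurable fun a => (κ a).map fun b => f (a, b) := by
  refine Measure.measurable_of_measurable_coe _ fun s hs => ?_
  let K : ProbabilityTheory.Kernel α β := ⟨κ, hκ⟩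
  have : ProbabilityTheory.IsMarkovKernel K := ⟨hp⟩
  have h := ProbabilityTheory.Kernel.measurable_kernel_prodMk_left (κ := K) (hf hs)
  have e : (fun a => (κ a).map (fun b => f (a, b)) s) = fun a => K a (Prod.mk a ⁻¹' (f ⁻¹' s)) := by
    ext a
    rw [Measure.map_apply (by fun_prop) hs]
    rfl
  rwa [e]

lemma lintegral_bind_map_prodMk {α β γ : Type*} [MeasurableSpace α] [MeasurableSpace β]
    [MeasurableSpace γ] {κ : α → Measure β} (hκ : Measurable κ)
    (hp : ∀ a, IsProbabilityMeasure (κ a)) {f : α × β → γ} (hf : Measurable f)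
    (μ : Measure α) {F : γ → ℝ≥0∞} (hF : Measurable F) :
    ∫⁻ c, F c ∂(μ.bind fun a => (κ a).map fun b => f (a, b)) =
      ∫⁻ a, ∫⁻ b, F (f (a, b)) ∂(κ a) ∂μ := by
  rw [Measure.lintegral_bind (measurable_map_prodMk hκ hp hf).aemeasurable hF.aemeasurable]
  refine lintegral_congr fun a => ?_
  rw [lintegral_map hF (by fun_prop)]

lemma measurable_lintegral_prodMk {α β : Type*} [MeasurableSpace α] [MeasurableSpace β]
    {κ : α → Measure β} (hκ : Measurable κ)
    (hp : ∀ a, IsProbabilityMeasure (κ a)) {F : α × β → ℝ≥0∞} (hF : Measurable F) :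
    Measurable fun a => ∫⁻ b, F (a, b) ∂(κ a) := by
  let K : ProbabilityTheory.Kernel α β := ⟨κ, hκ⟩
  have : ProbabilityTheory.IsMarkovKernel K := ⟨hp⟩
  exact hF.lintegral_kernel_prod_right' (κ := K)

lemma measurable_finSnoc (X : Type*) [MeasurableSpace X] (n : ℕ) :
    Measurable fun p : (Fin (n + 1) → X) × X => (Fin.snoc p.1 p.2 : Fin (n + 1 + 1) → X) := by
  refine measurable_pi_lambda _ fun i => ?_
  refine Fin.lastCases ?_ (fun j => ?_) i
  · simpa using measurable_snd
  · simp only [Fin.snoc_castSucc]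
    fun_prop

section Chain

variable {X : Type*} [MeasurableSpace X] {Q : X → Measure X} {μ : Measure X}

lemma lintegral_markovLaw_succ (hQ : IsTransKernel Q) (n : ℕ)
    {F : (Fin (n + 1 + 1) → X) → ℝ≥0∞} (hF : Measurable F) :
    ∫⁻ x, F x ∂(markovLaw μ Q (n + 1)) =
      ∫⁻ x, ∫⁻ y, F (Fin.snoc x y) ∂(Q (x (Fin.last n))) ∂(markovLaw μ Q n) :=
  lintegral_bind_map_prodMk (κ := fun x : Fin (n + 1) → X => Q (x (Fin.last n)))
    (hQ.1.comp (measurable_pi_apply _)) (fun _ => hQ.2 _) (measurable_finSnoc X n) _ hF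

lemma lintegral_markovLaw_zero {F : (Fin 1 → X) → ℝ≥0∞} (hF : Measurable F) :
    ∫⁻ x, F x ∂(markovLaw μ Q 0) = ∫⁻ x, F (fun _ => x) ∂μ :=
  lintegral_map hF (by fun_prop)

lemma lintegral_step2 (hQ : IsTransKernel Q) {F : X × X → ℝ≥0∞} (hF : Measurable F) :
    ∫⁻ p, F p ∂(step2 μ Q) = ∫⁻ x, ∫⁻ y, F (x, y) ∂(Q x) ∂μ :=
  lintegral_bind_map_prodMk (f := id) hQ.1 hQ.2 measurable_id μ hF

lemma isProbabilityMeasure_markovLaw (hQ : IsTransKernel Q) [IsProbabilityMeasure μ] (n : ℕ) :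
    IsProbabilityMeasure (markovLaw μ Q n) := by
  constructor
  rw [← lintegral_one]
  induction n with
  | zero => rw [lintegral_markovLaw_zero measurable_const]; simp
  | succ n ih =>
    have := hQ.2
    rw [lintegral_markovLaw_succ hQ n measurable_const]
    simpa using ih

lemma map_snd_step2 (hQ : IsTransKernel Q) (hinv : μ.bind Q = μ) :
    (step2 μ Q).map Prod.snd = μ := by
  conv_rhs => rw [← hinv]
  ext s hs
  rw [Measure.bind_apply hs hQ.1.aemeasurable, ← lintegral_indicator_one hs,
    lintegral_map (measurable_one.indicator hs) measurable_snd,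
    lintegral_step2 hQ (F := fun p => s.indicator 1 p.2)
      ((measurable_one.indicator hs).comp measurable_snd)]
  exact lintegral_congr fun x => lintegral_indicator_one hs

lemma IsBackwardCondKernel.lintegral {R : X → Measure X} {M : Set (X × X)}
    (hQ : IsTransKernel Q) (hinv : μ.bind Q = μ)
    (hR : IsBackwardCondKernel (step2 μ Q) M R) {F : X × X → ℝ≥0∞} (hF : Measurable F) :
    ∫⁻ x, ∫⁻ y, F (x, y) ∂(Q x) ∂μ = ∫⁻ y, ∫⁻ x, F (x, y) ∂(R y) ∂μ := by
  have hm : Measurable fun y => (R y).map fun x => (x, y) :=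
    measurable_map_prodMk hR.1 hR.2.1 measurable_swap
  have key : step2 μ Q = μ.bind fun y => (R y).map fun x => (x, y) := by
    ext C hC
    rw [hR.2.2.2 C hC, map_snd_step2 hQ hinv, Measure.bind_apply hC hm.aemeasurable]
    refine lintegral_congr fun y => ?_
    rw [Measure.map_apply (by fun_prop) hC]
    rfl
  rw [← lintegral_step2 hQ hF, key]
  exact lintegral_bind_map_prodMk hR.1 hR.2.1 measurable_swap μ hF

/-- Conditionally on the states at positive times, the initial state of a stationary chain is
distributed according to the backward kernel at the state at time one. -/
lemma lintegral_markovLaw_tail {R : X → Measure X} {M : Set (X × X)}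
    (hQ : IsTransKernel Q) (hinv : μ.bind Q = μ)
    (hR : IsBackwardCondKernel (step2 μ Q) M R) {h : X → ℝ≥0∞} (hh : Measurable h) (n : ℕ)
    {F : (Fin (n + 1) → X) → ℝ≥0∞} (hF : Measurable F) :
    ∫⁻ x, h (x 0) * F (Fin.tail x) ∂(markovLaw μ Q (n + 1)) =
      ∫⁻ x, (∫⁻ z, h z ∂(R (x 0))) * F x ∂(markovLaw μ Q n) := by
  have htail : ∀ k, Measurable fun x : Fin (k + 1 + 1) → X => (Fin.tail x : Fin (k + 1) → X) :=
    fun k => measurable_pi_lambda _ fun i => measurable_pi_apply _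
  have hRh : Measurable fun y => ∫⁻ z, h z ∂(R y) :=
    (Measure.measurable_lintegral hh).comp hR.1
  have hL : ∀ k (F : (Fin (k + 1) → X) → ℝ≥0∞), Measurable F →
      Measurable fun x : Fin (k + 1 + 1) → X => h (x 0) * F (Fin.tail x) := fun k F hF =>
    (hh.comp (measurable_pi_apply _)).mul (hF.comp (htail k))
  have hS : ∀ k (F : (Fin (k + 1) → X) → ℝ≥0∞), Measurable F →
      Measurable fun x : Fin (k + 1) → X => (∫⁻ z, h z ∂(R (x 0))) * F x := fun k F hF =>
    (hRh.comp (measurable_pi_apply _)).mul hF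
  induction n with
  | zero =>
    rw [lintegral_markovLaw_succ hQ 0 (hL 0 F hF),
      lintegral_markovLaw_zero (by
        have := measurable_lintegral_prodMk (κ := fun x : Fin 1 → X => Q (x (Fin.last 0)))
          (hQ.1.comp (measurable_pi_apply _)) (fun _ => hQ.2 _)
          (F := fun p => h ((Fin.snoc p.1 p.2 : Fin 2 → X) 0) *
            F (Fin.tail (Fin.snoc p.1 p.2 : Fin 2 → X)))
          ((hL 0 F hF).comp (measurable_finSnoc X 0))
        exact this),
      lintegral_markovLaw_zero (hS 0 F hF)]
    have e : ∀ x y : X, h ((Fin.snoc (fun _ : Fin 1 => x) y : Fin 2 → X) 0) *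
        F (Fin.tail (Fin.snoc (fun _ : Fin 1 => x) y : Fin 2 → X)) = h x * F fun _ => y := by
      intro x y
      congr 2
    simp only [e]
    have hF' : Measurable fun y : X => F fun _ => y := hF.comp (by fun_prop)
    rw [hR.lintegral hQ hinv (F := fun p => h p.1 * F fun _ => p.2)
      ((hh.comp measurable_fst).mul (hF'.comp measurable_snd))]
    exact lintegral_congr fun y => lintegral_mul_const (F fun _ => y) hh
  | succ n ih =>
    rw [lintegral_markovLaw_succ hQ (n + 1) (hL _ F hF),
      lintegral_markovLaw_succ hQ n (hS _ F hF)]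
    have hG : Measurable fun x : Fin (n + 1) → X =>
        ∫⁻ y, F (Fin.snoc x y) ∂(Q (x (Fin.last n))) :=
      measurable_lintegral_prodMk (κ := fun x : Fin (n + 1) → X => Q (x (Fin.last n)))
        (hQ.1.comp (measurable_pi_apply _)) (fun _ => hQ.2 _)
        (F := fun p => F (Fin.snoc p.1 p.2)) (hF.comp (measurable_finSnoc X n))
    have hm : ∀ x : Fin (n + 1) → X, Measurable fun y => F (Fin.snoc x y) := fun x =>
      (hF.comp (measurable_finSnoc X n)).comp (measurable_const.prodMk measurable_id)
    convert ih hG using 1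
    · refine lintegral_congr fun x => ?_
      rw [← lintegral_const_mul _ (hm _)]
      refine lintegral_congr fun y => ?_
      congr 2
      ext i
      refine Fin.lastCases ?_ (fun j => ?_) i
      · simp [Fin.tail, Fin.snoc]
      · simp [Fin.tail, ← Fin.castSucc_succ]
    · refine lintegral_congr fun x => ?_
      rw [← lintegral_const_mul _ (hm _)]
      rfl

end Chain

section Trajectory

open ProbabilityTheory

variable {X : Type*} [MeasurableSpace X] {Q : X → Measure X} {μ : Measure X}

lemma exists_isTrajLaw (hQ : IsTransKernel Q) [IsProbabilityMeasure μ] :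
    ∃ ν, IsTrajLaw μ Q ν := by
  let K : Kernel X X := ⟨Q, hQ.1⟩
  have hK : IsMarkovKernel K := ⟨hQ.2⟩
  let κ : (n : ℕ) → Kernel (Π _ : Finset.Iic n, X) X := fun n =>
    K.comap (fun x => x ⟨n, by simp⟩) (measurable_pi_apply _)
  have hκ : ∀ n, IsMarkovKernel (κ n) := fun n => inferInstanceAs (IsMarkovKernel (K.comap _ _))
  let ν : Measure (ℕ → X) := Kernel.trajMeasure (X := fun _ => X) μ κ
  have hν : IsProbabilityMeasure ν := inferInstanceAs
    (IsProbabilityMeasure (Kernel.trajMeasure (X := fun _ => X) μ κ))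
  refine ⟨ν, hν, fun n => ?_⟩
  induction n with
  | zero =>
    have h0 : ν.map (Preorder.frestrictLe (π := fun _ => X) 0) =
        μ.map (MeasurableEquiv.piUnique fun _ : Finset.Iic 0 => X).symm := by
      change (Kernel.trajMeasure (X := fun _ => X) μ κ).map _ = _
      rw [Kernel.trajMeasure, Measure.map_comp _ _ (by fun_prop), Kernel.traj_map_frestrictLe,
        Kernel.partialTraj_self, Measure.id_comp]
    have h1 := congrArg (Measure.map fun (x : Π _ : Finset.Iic 0, X) (_ : Fin 1) =>
      x ⟨0, by simp⟩) h0
    rw [Measure.map_map (by fun_prop) (by fun_prop),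
      Measure.map_map (by fun_prop) (by fun_prop)] at h1
    have e : (fun (x : ℕ → X) (i : Fin (0 + 1)) => x i) =
        (fun (x : Π _ : Finset.Iic 0, X) (_ : Fin 1) => x ⟨0, by simp⟩) ∘
          Preorder.frestrictLe (π := fun _ => X) 0 := by
      ext x i
      simp
    rw [e, h1]
    rfl
  | succ n ih =>
    have hst : ν.map (Preorder.frestrictLe (π := fun _ => X) n) ⊗ₘ κ n =
      ν.map (fun x ↦ (Preorder.frestrictLe (π := fun _ => X) n x, x (n + 1))) :=
      Kernel.map_frestrictLe_trajMeasure_compProd_eq_map_trajMeasure (X := fun _ => X) (κ := κ)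
        (μ₀ := μ) (a := n)
    have hmeas : ∀ k, Measurable fun (x : ℕ → X) (i : Fin (k + 1)) => x i := fun k => by fun_prop
    refine Measure.ext_of_lintegral _ fun F hF => ?_
    rw [lintegral_markovLaw_succ hQ n hF, ← ih, lintegral_map hF (hmeas _),
      lintegral_map (measurable_lintegral_prodMk
        (κ := fun x : Fin (n + 1) → X => Q (x (Fin.last n)))
        (hQ.1.comp (measurable_pi_apply _)) (fun _ => hQ.2 _)
        (F := fun p => F (Fin.snoc p.1 p.2)) (hF.comp (measurable_finSnoc X n))) (hmeas _)]
    let G : (Π _ : Finset.Iic n, X) × X → ℝ≥0∞ := fun p =>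
      F (Fin.snoc (fun i : Fin (n + 1) => p.1 ⟨i, by simpa using Nat.lt_succ_iff.1 i.2⟩) p.2)
    have hG : Measurable G := by
      refine hF.comp ((measurable_finSnoc X n).comp (f := fun p : (Π _ : Finset.Iic n, X) × X =>
        ((fun i : Fin (n + 1) => p.1 ⟨i, by simpa using Nat.lt_succ_iff.1 i.2⟩), p.2)) ?_)
      fun_prop
    have h2 := congrArg (fun m => ∫⁻ p, G p ∂m) hst
    rw [Measure.lintegral_compProd hG, lintegral_map hG (by fun_prop),
      lintegral_map (measurable_lintegral_prodMk (κ n).measurable inferInstance hG)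
        (by fun_prop)] at h2
    refine Eq.trans ?_ h2.symm
    refine lintegral_congr fun x => ?_
    congr 1
    ext i
    refine Fin.lastCases ?_ (fun j => ?_) i
    · simp
    · simp

end Trajectory

section Expansive

variable {X : Type*} [MetricSpace X] {T : X → Set X} {ε : ℝ} {m : ℕ} {p : X → Fin m}

lemma exists_measurable_dist_le_of_eq [CompactSpace X] [Nonempty X] [MeasurableSpace X]
    [BorelSpace X] (hε : 0 < ε) :
    ∃ (m : ℕ) (p : X → Fin m), Measurable p ∧ ∀ x y, p x = p y → dist x y ≤ ε := by
  let e := TopologicalSpace.denseSeq X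
  obtain ⟨t, ht⟩ := isCompact_univ.elim_finite_subcover (fun k => Metric.ball (e k) (ε / 2))
    (fun k => Metric.isOpen_ball) (fun x _ => by
      obtain ⟨k, hk⟩ := (TopologicalSpace.denseRange_denseSeq X).exists_dist_lt x (half_pos hε)
      exact mem_iUnion.2 ⟨k, Metric.mem_ball.2 hk⟩)
  let N := t.sup id
  have hN : ∀ x, dist (SimpleFunc.nearestPt e N x) x ≤ ε / 2 := by
    intro x
    obtain ⟨k, hk, hx⟩ := mem_iUnion₂.1 (ht (mem_univ x))
    have := SimpleFunc.edist_nearestPt_le e x (Finset.le_sup (f := id) hk : k ≤ N)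
    rw [edist_dist, edist_dist, ENNReal.ofReal_le_ofReal_iff dist_nonneg] at this
    exact this.trans (Metric.mem_ball'.1 hx).le
  refine ⟨N + 1, fun x => ⟨SimpleFunc.nearestPtInd e N x,
    Nat.lt_succ_of_le (SimpleFunc.nearestPtInd_le e N x)⟩, ?_, fun x y hxy => ?_⟩
  · refine measurable_to_countable' fun i => ?_
    have := (SimpleFunc.nearestPtInd e N).measurableSet_fiber i
    convert this using 1
    ext x
    simp [Fin.ext_iff]
  · have h : SimpleFunc.nearestPt e N x = SimpleFunc.nearestPt e N y := by
      simp only [SimpleFunc.nearestPt, SimpleFunc.map_apply]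
      rw [Fin.mk.inj_iff.1 hxy]
    have h1 := hN x
    have h2 := hN y
    rw [h] at h1
    have := dist_triangle_left x y (SimpleFunc.nearestPt e N y)
    linarith

lemma IsFwdExpansiveWith.eq_of_forall_eq (hT : IsFwdExpansiveWith T ε)
    (hp : ∀ x y, p x = p y → dist x y ≤ ε) {x y : ℕ → X} (hx : x ∈ orbitSpace T)
    (hy : y ∈ orbitSpace T) (h : ∀ n, p (x n) = p (y n)) : x = y := by
  by_contra hne
  obtain ⟨n, hn⟩ := hT.2 x hx y hy hne
  exact absurd (hp _ _ (h n)) (not_le.2 hn)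

lemma IsCorrespondence.exists_orbit (hT : IsCorrespondence T) (x : X) :
    ∃ o ∈ orbitSpace T, o 0 = x := by
  choose f hf using hT.1
  exact ⟨fun n => f^[n] x, fun k => by
    simp only [Function.iterate_succ_apply']
    exact hf _, rfl⟩

lemma IsFwdExpansiveWith.injOn_preimage (hC : IsCorrespondence T) (hT : IsFwdExpansiveWith T ε)
    (hp : ∀ x y, p x = p y → dist x y ≤ ε) (x : X) :
    InjOn p {z | (z, x) ∈ graph2 T} := by
  intro z hz z' hz' h
  obtain ⟨o, ho, rfl⟩ := hC.exists_orbit x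
  have horb : ∀ w, (w, o 0) ∈ graph2 T → (fun n => Nat.casesOn n w o : ℕ → X) ∈ orbitSpace T := by
    rintro w hw (_ | k)
    · exact hw
    · exact ho k
  refine congrFun (hT.eq_of_forall_eq hp (horb z hz) (horb z' hz') ?_) 0
  rintro (_ | n)
  · exact h
  · rfl

lemma atomEntropy_eq_of_injOn {Y : Type*} [MeasurableSpace Y] [MeasurableSingletonClass Y]
    {ρ : Measure Y} [IsProbabilityMeasure ρ] {p : Y → Fin m}
    {S : Set Y} (hS : ρ S = 1) (hinj : InjOn p S) :
    atomEntropy ρ = ENNReal.ofReal (∑ i, Real.negMulLog (ρ (p ⁻¹' {i})).toReal) := by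
  have hfin : S.Finite := Set.Finite.of_injOn (mapsTo_univ p S) hinj finite_univ
  have hS0 : ρ Sᶜ = 0 := (prob_compl_eq_zero_iff hfin.measurableSet).2 hS
  have hnn : ∀ s : Set Y, 0 ≤ Real.negMulLog (ρ s).toReal := fun s =>
    Real.negMulLog_nonneg ENNReal.toReal_nonneg (ENNReal.toReal_le_of_le_ofReal zero_le_one
      (by simpa using prob_le_one))
  rw [atomEntropy, if_pos ⟨S, hfin.countable, hfin.measurableSet, hS⟩,
    tsum_eq_sum (s := hfin.toFinset), ENNReal.ofReal_sum_of_nonneg fun i _ => hnn _]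
  · rw [← Finset.sum_subset (Finset.subset_univ (hfin.toFinset.image p)), Finset.sum_image]
    · refine Finset.sum_congr rfl fun y hy => ?_
      have hy' : y ∈ S := by simpa using hy
      congr 3
      refine le_antisymm (measure_mono (by simp)) ?_
      calc ρ (p ⁻¹' {p y}) ≤ ρ ({y} ∪ Sᶜ) := measure_mono fun z hz => by
            by_cases hzS : z ∈ S
            · exact Or.inl (hinj hzS hy' hz)
            · exact Or.inr hzS
        _ ≤ ρ {y} + ρ Sᶜ := measure_union_le _ _
        _ = ρ {y} := by rw [hS0, add_zero]
    · intro y hy z hz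
      exact hinj (by simpa using hy) (by simpa using hz)
    · intro i _ hi
      have : ρ (p ⁻¹' {i}) = 0 := measure_mono_null (fun z hz (hzS : z ∈ S) => hi (by
        simp only [Finset.mem_image, Set.Finite.mem_toFinset]
        exact ⟨z, hzS, hz⟩)) hS0
      simp [this]
  · intro y hy
    have : ρ {y} = 0 := measure_mono_null (fun z hz (hzS : z ∈ S) => hy (by
      rw [mem_singleton_iff.1 hz] at hzS
      simpa using hzS)) hS0
    simp [this]

end Expansive

section ConditionalEntropy

/-- Conditional expectation given a finite-valued random variable. -/
lemma condExp_comap_fintype {Ω W : Type*} [mΩ : MeasurableSpace Ω] [Fintype W]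
    [MeasurableSpace W] [MeasurableSingletonClass W] (P : Measure Ω) [IsFiniteMeasure P]
    {Y : Ω → W} (hY : Measurable Y) {g : Ω → ℝ} (hg : Integrable g P) :
    (fun ω => (∫ x in Y ⁻¹' {Y ω}, g x ∂P) / P.real (Y ⁻¹' {Y ω})) =ᵐ[P]
      P[g | MeasurableSpace.comap Y inferInstance] := by
  have hc : Measurable fun w => (∫ x in Y ⁻¹' {w}, g x ∂P) / P.real (Y ⁻¹' {w}) :=
    measurable_of_finite _
  have hintg : Integrable (fun ω => (∫ x in Y ⁻¹' {Y ω}, g x ∂P) / P.real (Y ⁻¹' {Y ω})) P :=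
    (Integrable.of_finite (μ := P.map Y)
      (f := fun w => (∫ x in Y ⁻¹' {w}, g x ∂P) / P.real (Y ⁻¹' {w}))).comp_measurable hY
  refine ae_eq_condExp_of_forall_setIntegral_eq hY.comap_le hg (fun s _ _ => hintg.integrableOn) ?_
    (hc.comp (comap_measurable Y)).aestronglyMeasurable
  rintro _ ⟨t, ht, rfl⟩ -
  have hs : Y ⁻¹' t = ⋃ w ∈ Finset.univ.filter (· ∈ t), Y ⁻¹' {w} := by
    ext ω
    simp
  have hd : Set.Pairwise (↑(Finset.univ.filter (· ∈ t)))
      (Function.onFun Disjoint fun w => Y ⁻¹' {w}) := fun a _ b _ hab =>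
    (Set.disjoint_singleton.2 hab).preimage Y
  have hm : ∀ w ∈ Finset.univ.filter (· ∈ t), MeasurableSet (Y ⁻¹' {w}) := fun w _ =>
    hY (measurableSet_singleton w)
  rw [hs, integral_biUnion_finset _ hm hd fun _ _ => hintg.integrableOn,
    integral_biUnion_finset _ hm hd fun _ _ => hg.integrableOn]
  refine Finset.sum_congr rfl fun w hw => ?_
  rw [setIntegral_congr_fun (hm w hw)
    (g := fun _ => (∫ x in Y ⁻¹' {w}, g x ∂P) / P.real (Y ⁻¹' {w}))
    (fun ω hω => by simp only [show Y ω = w from hω]), setIntegral_const, smul_eq_mul]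
  by_cases h0 : P.real (Y ⁻¹' {w}) = 0
  · have h0' : P (Y ⁻¹' {w}) = 0 := by simpa [measureReal_def, ENNReal.toReal_eq_zero_iff] using h0
    rw [h0, zero_mul, setIntegral_measure_zero _ h0']
  · field_simp

lemma integral_comp_fintype {Ω W : Type*} [MeasurableSpace Ω] [Fintype W] [MeasurableSpace W]
    [MeasurableSingletonClass W] (P : Measure Ω) [IsFiniteMeasure P] {Y : Ω → W}
    (hY : Measurable Y) (c : W → ℝ) :
    ∫ ω, c (Y ω) ∂P = ∑ w, P.real (Y ⁻¹' {w}) * c w := by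
  rw [← integral_map hY.aemeasurable (measurable_of_finite c).aestronglyMeasurable,
    integral_fintype .of_finite]
  refine Finset.sum_congr rfl fun w _ => ?_
  rw [map_measureReal_apply hY (measurableSet_singleton w), smul_eq_mul]

lemma sum_negMulLog_sub_negMulLog_sum {ι : Type*} [Fintype ι] {r : ι → ℝ} (hr : ∀ i, 0 ≤ r i) :
    ∑ i, Real.negMulLog (r i) - Real.negMulLog (∑ i, r i) =
      ∑ i, (∑ j, r j) * Real.negMulLog (r i / ∑ j, r j) := by
  by_cases h0 : ∑ j, r j = 0
  · have h : ∀ i, r i = 0 := fun i =>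
      (Finset.sum_eq_zero_iff_of_nonneg fun i _ => hr i).1 h0 i (Finset.mem_univ i)
    simp [h]
  · have h : ∀ i, Real.negMulLog (r i) = r i / (∑ j, r j) * Real.negMulLog (∑ j, r j) +
        (∑ j, r j) * Real.negMulLog (r i / ∑ j, r j) := fun i => by
      rw [← Real.negMulLog_mul, mul_div_cancel₀ _ h0]
    simp only [h, Finset.sum_add_distrib, ← Finset.sum_mul, ← Finset.sum_div, div_self h0]
    ring

lemma negMulLog_sum_le {ι : Type*} (s : Finset ι) {r : ι → ℝ} (hr : ∀ i, 0 ≤ r i) :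
    Real.negMulLog (∑ i ∈ s, r i) ≤ ∑ i ∈ s, Real.negMulLog (r i) := by
  rw [← Finset.sum_coe_sort s, ← Finset.sum_coe_sort s, ← sub_nonneg,
    sum_negMulLog_sub_negMulLog_sum fun i => hr _]
  have hs : 0 ≤ ∑ j : s, r j := Finset.sum_nonneg fun j _ => hr _
  exact Finset.sum_nonneg fun i _ => mul_nonneg hs (Real.negMulLog_nonneg
    (div_nonneg (hr _) hs) (div_le_one_of_le₀ (Finset.single_le_sum (f := fun j : s => r j)
      (fun j _ => hr _) (Finset.mem_univ i)) hs))

lemma partEntropy_nonneg {Y I : Type*} [MeasurableSpace Y] [Fintype I] (ν : Measure Y)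
    [IsProbabilityMeasure ν] (p : Y → I) : 0 ≤ partEntropy ν p :=
  Finset.sum_nonneg fun _ _ => Real.negMulLog_nonneg measureReal_nonneg measureReal_le_one

/-- Passing to a coarser partition decreases the entropy. -/
lemma partEntropy_comp_le {Y I J : Type*} [MeasurableSpace Y] [Fintype I] [Fintype J]
    (ν : Measure Y) [IsProbabilityMeasure ν] {p : Y → I} (hp : ∀ i, MeasurableSet (p ⁻¹' {i}))
    (f : I → J) : partEntropy ν (f ∘ p) ≤ partEntropy ν p := by
  have hsum : ∀ j, (ν (f ∘ p ⁻¹' {j})).toReal =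
      ∑ i ∈ Finset.univ.filter (f · = j), (ν (p ⁻¹' {i})).toReal := by
    intro j
    rw [← ENNReal.toReal_sum fun i _ => measure_ne_top _ _, ← measure_biUnion_finset
      (fun a _ b _ hab => (Set.disjoint_singleton.2 hab).preimage p) fun i _ => hp i]
    congr 2
    ext y
    simp
  unfold partEntropy
  rw [← Finset.sum_fiberwise Finset.univ f]
  refine Finset.sum_le_sum fun j _ => ?_
  rw [hsum]
  exact negMulLog_sum_le _ fun i => ENNReal.toReal_nonneg

end ConditionalEntropy

section Itinerary

variable {X : Type*} [MeasurableSpace X] {T : X → Set X} {Q R : X → Measure X} {μ : Measure X}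
  {ν : Measure (ℕ → X)} {m : ℕ} {p : X → Fin m}

/-- The partition of the sequence space according to the first `n + 1` symbols. -/
def itinerary (p : X → Fin m) (n : ℕ) (x : ℕ → X) : Fin (n + 1) → Fin m := fun i => p (x i)

lemma measurable_itinerary (hp : Measurable p) (n : ℕ) : Measurable (itinerary p n) := by
  unfold itinerary
  fun_prop

lemma IsTrajLaw.markovLaw_preimage (hν : IsTrajLaw μ Q ν) (hp : Measurable p) (n : ℕ)
    (w : Fin (n + 1) → Fin m) :
    markovLaw μ Q n ((fun x => p ∘ x) ⁻¹' {w}) = ν (itinerary p n ⁻¹' {w}) := by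
  have h : Measurable fun x : Fin (n + 1) → X => p ∘ x :=
    measurable_pi_lambda _ fun i => hp.comp (measurable_pi_apply i)
  rw [← hν.2 n, Measure.map_apply (by fun_prop) (h (measurableSet_singleton w))]
  rfl

lemma IsTrajLaw.markovLaw_preimage_cons (hQ : IsTransKernel Q) (hinv : μ.bind Q = μ)
    (hR : IsBackwardCondKernel (step2 μ Q) (graph2 T) R) (hν : IsTrajLaw μ Q ν)
    (hp : Measurable p) (n : ℕ) (i : Fin m) (w : Fin (n + 1) → Fin m) :
    (markovLaw μ Q (n + 1)
        ((fun x => p ∘ x) ⁻¹' {(Fin.cons i w : Fin (n + 1 + 1) → Fin m)})).toReal =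
      ∫ x in itinerary p n ⁻¹' {w}, (R (x 0) (p ⁻¹' {i})).toReal ∂ν := by
  have hpk : ∀ k, Measurable fun x : Fin k → X => p ∘ x := fun k =>
    measurable_pi_lambda _ fun i => hp.comp (measurable_pi_apply i)
  have hA : MeasurableSet (p ⁻¹' {i}) := hp (measurableSet_singleton i)
  have hB : MeasurableSet ((fun x : Fin (n + 1) → X => p ∘ x) ⁻¹' {w}) :=
    hpk _ (measurableSet_singleton w)
  have hRm : Measurable fun z => R z (p ⁻¹' {i}) := (Measure.measurable_coe hA).comp hR.1
  have hw : MeasurableSet (itinerary p n ⁻¹' {w}) :=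
    measurable_itinerary hp n (measurableSet_singleton w)
  have hlt : ∀ z, R z (p ⁻¹' {i}) < ∞ := fun z => by
    have := hR.2.1 z
    exact measure_lt_top _ _
  rw [integral_toReal (f := fun x : ℕ → X => R (x 0) (p ⁻¹' {i}))
    (hRm.comp (measurable_pi_apply 0)).aemeasurable (ae_of_all _ fun x => hlt _)]
  congr 1
  have key := lintegral_markovLaw_tail hQ hinv hR (h := (p ⁻¹' {i}).indicator 1)
    (measurable_one.indicator hA) n
    (F := ((fun x : Fin (n + 1) → X => p ∘ x) ⁻¹' {w}).indicator 1) (measurable_one.indicator hB)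
  simp only [lintegral_indicator_one hA] at key
  rw [← lintegral_indicator hw, ← lintegral_indicator_one (hpk _ (measurableSet_singleton _))]
  refine Eq.trans (lintegral_congr fun x => ?_) (key.trans ?_)
  · have : (fun x => p ∘ x) x = (Fin.cons i w : Fin (n + 1 + 1) → Fin m) ↔
        p (x 0) = i ∧ p ∘ Fin.tail x = w := by
      constructor
      · intro h
        refine ⟨by simpa using congrFun h 0, ?_⟩
        ext j
        simpa [Fin.tail] using congrArg Fin.val (congrFun h j.succ)
      · rintro ⟨rfl, rfl⟩
        ext j
        refine Fin.cases ?_ (fun j => ?_) j <;> simp [Fin.tail]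
    by_cases h1 : p (x 0) = i <;> by_cases h2 : p ∘ Fin.tail x = w <;>
      simp [Set.indicator, this, h1, h2]
  · have hF : Measurable fun x : Fin (n + 1) → X => R (x 0) (p ⁻¹' {i}) *
        ((fun x : Fin (n + 1) → X => p ∘ x) ⁻¹' {w}).indicator 1 x :=
      (hRm.comp (measurable_pi_apply 0)).mul (measurable_one.indicator hB)
    rw [← hν.2 n, lintegral_map hF (by fun_prop)]
    refine lintegral_congr fun x => ?_
    have : p ∘ (fun j : Fin (n + 1) => x j) = itinerary p n x := rfl
    by_cases h : itinerary p n x = w <;> simp [Set.indicator, this, h]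

lemma partEntropy_succ_sub (hQ : IsTransKernel Q) (hinv : μ.bind Q = μ)
    (hR : IsBackwardCondKernel (step2 μ Q) (graph2 T) R) (hν : IsTrajLaw μ Q ν)
    (hp : Measurable p) (n : ℕ) :
    partEntropy (markovLaw μ Q (n + 1)) (fun x => p ∘ x) -
        partEntropy (markovLaw μ Q n) (fun x => p ∘ x) =
      ∑ i, ∫ ω, Real.negMulLog
        ((∫ x in itinerary p n ⁻¹' {itinerary p n ω}, (R (x 0) (p ⁻¹' {i})).toReal ∂ν) /
          ν.real (itinerary p n ⁻¹' {itinerary p n ω})) ∂ν := by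
  have := hν.1
  have hY := measurable_itinerary hp n
  set r : Fin m → (Fin (n + 1) → Fin m) → ℝ := fun i w =>
    ∫ x in itinerary p n ⁻¹' {w}, (R (x 0) (p ⁻¹' {i})).toReal ∂ν with hr
  have hr0 : ∀ i w, 0 ≤ r i w := fun i w => integral_nonneg fun x => ENNReal.toReal_nonneg
  have hgm : ∀ i, Measurable fun x : ℕ → X => (R (x 0) (p ⁻¹' {i})).toReal := fun i =>
    ((Measure.measurable_coe (hp (measurableSet_singleton i))).comp
      (hR.1.comp (measurable_pi_apply 0))).ennreal_toReal
  have hgi : ∀ i, Integrable (fun x : ℕ → X => (R (x 0) (p ⁻¹' {i})).toReal) ν := fun i => by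
    refine Integrable.of_bound (hgm i).aestronglyMeasurable 1 (ae_of_all _ fun x => ?_)
    have := hR.2.1 (x 0)
    rw [Real.norm_of_nonneg ENNReal.toReal_nonneg]
    exact measureReal_le_one
  have hsum : ∀ w, ∑ i, r i w = ν.real (itinerary p n ⁻¹' {w}) := by
    intro w
    rw [hr, ← integral_finsetSum _ fun i _ => (hgi i).integrableOn]
    have h1 : ∀ x : ℕ → X, ∑ i, (R (x 0) (p ⁻¹' {i})).toReal = 1 := fun x => by
      have := hR.2.1 (x 0)
      rw [← ENNReal.toReal_sum fun i _ => measure_ne_top _ _, sum_measure_preimage_singleton _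
        fun i _ => hp (measurableSet_singleton i)]
      simp
    simp [h1]
  have h1 : partEntropy (markovLaw μ Q (n + 1)) (fun x => p ∘ x) =
      ∑ w, ∑ i, Real.negMulLog (r i w) := by
    rw [Finset.sum_comm, ← Fintype.sum_prod_type', partEntropy]
    refine (Fintype.sum_equiv (Fin.consEquiv fun _ => Fin m) _ _ fun iw => ?_).symm
    exact congrArg Real.negMulLog (hν.markovLaw_preimage_cons hQ hinv hR hp n iw.1 iw.2).symm
  have h2 : partEntropy (markovLaw μ Q n) (fun x => p ∘ x) =
      ∑ w, Real.negMulLog (∑ i, r i w) := by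
    refine Finset.sum_congr rfl fun w _ => ?_
    rw [hν.markovLaw_preimage hp, hsum]
    rfl
  rw [h1, h2, ← Finset.sum_sub_distrib, Finset.sum_congr rfl fun w _ =>
    sum_negMulLog_sub_negMulLog_sum fun i => hr0 i w, Finset.sum_comm]
  refine Finset.sum_congr rfl fun i _ => ?_
  rw [integral_comp_fintype ν hY fun w => Real.negMulLog (r i w / ν.real (itinerary p n ⁻¹' {w}))]
  simp only [hsum]

/-- The filtration generated by the itineraries. -/
def itineraryFiltration (hp : Measurable p) :
    Filtration ℕ (inferInstance : MeasurableSpace (ℕ → X)) where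
  seq n := MeasurableSpace.comap (itinerary p n) inferInstance
  mono' k n hkn := by
    have e : itinerary p k = (fun w i => w (Fin.castLE (Nat.succ_le_succ hkn) i)) ∘
      itinerary p n := rfl
    change MeasurableSpace.comap (itinerary p k) inferInstance ≤
      MeasurableSpace.comap (itinerary p n) inferInstance
    rw [e, ← MeasurableSpace.comap_comp]
    exact MeasurableSpace.comap_mono (Measurable.comap_le (measurable_of_finite _))
  le' n := (measurable_itinerary hp n).comap_le

end Itinerary

section Convergence

variable {X : Type*} [MetricSpace X] [CompactSpace X] [MeasurableSpace X] [BorelSpace X]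
  {T : X → Set X} {Q R : X → Measure X} {μ : Measure X} {ν : Measure (ℕ → X)} {m : ℕ}
  {p : X → Fin m}

lemma IsCorrespondence.measurableSet_orbitSpace (hC : IsCorrespondence T) :
    MeasurableSet (orbitSpace T) := by
  rw [orbitSpace, ofPred_forall]
  exact MeasurableSet.iInter fun k => hC.2.2.measurableSet.preimage
    (f := fun x : ℕ → X => (x k, x (k + 1))) (by fun_prop)

lemma IsTrajLaw.ae_mem_orbitSpace (hC : IsCorrespondence T) (hQ : IsTransKernel Q)
    (hsupp : SupportedBy T Q) (hν : IsTrajLaw μ Q ν) : ∀ᵐ x ∂ν, x ∈ orbitSpace T := by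
  refine ae_all_iff.2 fun k => ?_
  have hm : Measurable fun (x : ℕ → X) (i : Fin (k + 1 + 1)) => x i := by fun_prop
  have hG : MeasurableSet
      {y : Fin (k + 1 + 1) → X | y (Fin.last (k + 1)) ∈ T (y (Fin.last k).castSucc)} :=
    hC.2.2.measurableSet.preimage (f := fun y : Fin (k + 1 + 1) → X =>
      (y (Fin.last k).castSucc, y (Fin.last (k + 1)))) (by fun_prop)
  have h : ∀ᵐ y ∂(markovLaw μ Q (k + 1)),
      y (Fin.last (k + 1)) ∈ T (y (Fin.last k).castSucc) := by
    rw [ae_iff]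
    change markovLaw μ Q (k + 1) {y | y (Fin.last (k + 1)) ∈ T (y (Fin.last k).castSucc)}ᶜ = 0
    rw [← lintegral_indicator_one hG.compl, lintegral_markovLaw_succ hQ k
      (measurable_one.indicator hG.compl)]
    refine (lintegral_congr fun x => ?_).trans lintegral_zero
    have := hQ.2 (x (Fin.last k))
    have h0 := (prob_compl_eq_zero_iff (hC.2.1 (x (Fin.last k))).measurableSet).2
      (hsupp (x (Fin.last k)))
    rw [← lintegral_indicator_one (hC.2.1 (x (Fin.last k))).measurableSet.compl] at h0
    rw [← h0]
    refine lintegral_congr fun y => ?_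
    simp [Set.indicator]
  rw [← hν.2 (k + 1)] at h
  exact ae_of_ae_map hm.aemeasurable h

lemma IsBackwardCondKernel.ae_apply_eq_one (hC : IsCorrespondence T) (hQ : IsTransKernel Q)
    (hsupp : SupportedBy T Q) [IsProbabilityMeasure μ] (hinv : μ.bind Q = μ)
    (hR : IsBackwardCondKernel (step2 μ Q) (graph2 T) R) :
    ∀ᵐ x ∂μ, R x {z | (z, x) ∈ graph2 T} = 1 := by
  have hcl : IsClosed (Prod.snd '' graph2 T) := (hC.2.2.isCompact.image continuous_snd).isClosed
  have h : ∀ᵐ x ∂(μ.bind Q), x ∈ Prod.snd '' graph2 T := by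
    rw [ae_iff]
    change μ.bind Q (Prod.snd '' graph2 T)ᶜ = 0
    rw [Measure.bind_apply hcl.measurableSet.compl hQ.1.aemeasurable]
    refine (lintegral_congr fun x => ?_).trans lintegral_zero
    have := hQ.2 x
    refine measure_mono_null (compl_subset_compl.2 fun y hy => ?_)
      ((prob_compl_eq_zero_iff (hC.2.1 x).measurableSet).2 (hsupp x))
    exact ⟨(x, y), hy, rfl⟩
  rw [hinv] at h
  filter_upwards [h] with x hx using hR.2.2.1 x hx

/-- For an expansive correspondence and a fine partition, every measurable function on the
sequence space is a.e. equal to a function of the full itinerary. -/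
lemma IsTrajLaw.exists_ae_eq_measurable_iSup {ε : ℝ} (hC : IsCorrespondence T)
    (hT : IsFwdExpansiveWith T ε) (hQ : IsTransKernel Q) (hsupp : SupportedBy T Q)
    (hν : IsTrajLaw μ Q ν) (hp : Measurable p) (hfine : ∀ x y, p x = p y → dist x y ≤ ε)
    {g : (ℕ → X) → ℝ} (hg : Measurable g) :
    ∃ g' : (ℕ → X) → ℝ, Measurable[⨆ n, itineraryFiltration hp n] g' ∧ g =ᵐ[ν] g' := by
  have hO := hC.measurableSet_orbitSpace
  have : StandardBorelSpace (orbitSpace T) := hO.standardBorel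
  let f : orbitSpace T → ℕ → Fin m := fun x n => p (x.1 n)
  have hf : Measurable f := measurable_pi_lambda _ fun n =>
    hp.comp ((measurable_pi_apply n).comp measurable_subtype_coe)
  have hfi : Function.Injective f := fun x y hxy =>
    Subtype.ext (hT.eq_of_forall_eq hfine x.2 y.2 fun n => congrFun hxy n)
  obtain ⟨φ, hφ, hφf⟩ := (hf.measurableEmbedding hfi).exists_measurable_extend
    (hg.comp measurable_subtype_coe) fun _ => ⟨0⟩
  refine ⟨fun x => φ fun n => p (x n), ?_, ?_⟩
  · refine hφ.comp (@measurable_pi_lambda _ _ _ (_) _ _ fun n => ?_)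
    have h : Measurable[itineraryFiltration hp n] (itinerary p n) := comap_measurable _
    exact Measurable.mono ((measurable_pi_apply (Fin.last n)).comp h)
      (le_iSup (fun n => itineraryFiltration hp n) n) le_rfl
  · filter_upwards [hν.ae_mem_orbitSpace hC hQ hsupp] with x hx
    exact (congrFun hφf ⟨x, hx⟩).symm

lemma tendsto_partEntropy_succ_sub {ε : ℝ} (hC : IsCorrespondence T)
    (hT : IsFwdExpansiveWith T ε) (hQ : IsTransKernel Q) (hsupp : SupportedBy T Q)
    [IsProbabilityMeasure μ] (hinv : μ.bind Q = μ)
    (hR : IsBackwardCondKernel (step2 μ Q) (graph2 T) R)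
    (hp : Measurable p) (hfine : ∀ x y, p x = p y → dist x y ≤ ε) :
    Tendsto (fun n => partEntropy (markovLaw μ Q (n + 1)) (fun x => p ∘ x) -
        partEntropy (markovLaw μ Q n) (fun x => p ∘ x)) atTop
      (𝓝 (∑ i, ∫ x, Real.negMulLog (R x (p ⁻¹' {i})).toReal ∂μ)) := by
  obtain ⟨ν, hν⟩ := exists_isTrajLaw (μ := μ) hQ
  have := hν.1
  simp only [partEntropy_succ_sub hQ hinv hR hν hp]
  refine tendsto_finsetSum _ fun i _ => ?_
  have hRm : Measurable fun z => (R z (p ⁻¹' {i})).toReal :=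
    ((Measure.measurable_coe (hp (measurableSet_singleton i))).comp hR.1).ennreal_toReal
  have hR1 : ∀ z, (R z (p ⁻¹' {i})).toReal ≤ 1 := fun z => by
    have := hR.2.1 z
    exact measureReal_le_one
  set g : (ℕ → X) → ℝ := fun x => (R (x 0) (p ⁻¹' {i})).toReal with hg
  have hgm : Measurable g := hRm.comp (measurable_pi_apply 0)
  have hgi : Integrable g ν := by
    refine Integrable.of_bound hgm.aestronglyMeasurable 1 (ae_of_all _ fun x => ?_)
    rw [Real.norm_of_nonneg ENNReal.toReal_nonneg]
    exact hR1 _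
  have hlim : ∫ x, Real.negMulLog (R x (p ⁻¹' {i})).toReal ∂μ = ∫ x, Real.negMulLog (g x) ∂ν := by
    have hmap : ν.map (fun x => x 0) = μ := by
      have h := congrArg (Measure.map fun y : Fin 1 → X => y 0) (hν.2 0)
      rw [Measure.map_map (by fun_prop) (by fun_prop), markovLaw,
        Measure.map_map (by fun_prop) (by fun_prop)] at h
      exact h.trans Measure.map_id
    conv_lhs => rw [← hmap]
    rw [integral_map (φ := fun x : ℕ → X => x 0)
      (measurable_pi_apply 0).aemeasurable
      (f := fun z => Real.negMulLog (R z (p ⁻¹' {i})).toReal)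
      (Real.continuous_negMulLog.measurable.comp hRm).aestronglyMeasurable]
  rw [hlim]
  set c : ℕ → (ℕ → X) → ℝ := fun n ω => (∫ x in itinerary p n ⁻¹' {itinerary p n ω}, g x ∂ν) /
    ν.real (itinerary p n ⁻¹' {itinerary p n ω}) with hc
  have hcm : ∀ n, Measurable (c n) := fun n =>
    (measurable_of_finite fun w => (∫ x in itinerary p n ⁻¹' {w}, g x ∂ν) /
      ν.real (itinerary p n ⁻¹' {w})).comp (measurable_itinerary hp n)
  have hc0 : ∀ n ω, 0 ≤ c n ω := fun n ω =>
    div_nonneg (integral_nonneg fun x => ENNReal.toReal_nonneg) measureReal_nonneg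
  have hc1 : ∀ n ω, c n ω ≤ 1 := fun n ω => by
    refine div_le_one_of_le₀ ?_ measureReal_nonneg
    refine (integral_mono hgi.integrableOn (integrable_const 1) fun x => hR1 _).trans ?_
    simp
  refine tendsto_integral_of_dominated_convergence (fun _ => 1)
    (fun n => (Real.continuous_negMulLog.measurable.comp (hcm n)).aestronglyMeasurable)
    (integrable_const 1) (fun n => ae_of_all _ fun ω => ?_) ?_
  · rw [Real.norm_of_nonneg (Real.negMulLog_nonneg (hc0 n ω) (hc1 n ω))]
    linarith [Real.negMulLog_le_one_sub_self (hc0 n ω), hc0 n ω]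
  · obtain ⟨g', hg'm, hgg'⟩ := hν.exists_ae_eq_measurable_iSup hC hT hQ hsupp hp hfine hgm
    have hconv := (hgi.congr hgg').tendsto_ae_condExp (ℱ := itineraryFiltration hp)
      hg'm.stronglyMeasurable
    have hce : ∀ᵐ ω ∂ν, ∀ n, c n ω = (ν[g' | itineraryFiltration hp n]) ω := by
      refine ae_all_iff.2 fun n => ?_
      exact (condExp_comap_fintype ν (measurable_itinerary hp n) hgi).trans
        (condExp_congr_ae hgg')
    filter_upwards [hconv, hce, hgg'] with ω h1 h2 h3
    rw [h3]
    exact ((Real.continuous_negMulLog.tendsto _).comp h1).congr fun n =>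
      congrArg Real.negMulLog (h2 n).symm

end Convergence

lemma tendsto_inv_mul_of_tendsto_sub {a : ℕ → ℝ} {l : ℝ}
    (h : Tendsto (fun n => a (n + 1) - a n) atTop (𝓝 l)) :
    Tendsto (fun n : ℕ => (n : ℝ)⁻¹ * a (n - 1)) atTop (𝓝 l) := by
  let u : ℕ → ℝ := fun n => a n - if n = 0 then 0 else a (n - 1)
  have hu : Tendsto u atTop (𝓝 l) := by
    rw [← tendsto_add_atTop_iff_nat 1]
    simpa [u] using h
  refine hu.cesaro.congr' ?_
  filter_upwards [eventually_ge_atTop 1] with n hn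
  obtain ⟨k, rfl⟩ := Nat.exists_eq_add_of_le' hn
  congr 1
  rw [Finset.sum_range_succ']
  have h := Finset.sum_range_sub a k
  simp_all [u]

section Rokhlin

variable {X : Type*} [MetricSpace X] [CompactSpace X] [MeasurableSpace X] [BorelSpace X]
  {T : X → Set X} {Q R : X → Measure X} {μ : Measure X} {m : ℕ} {p : X → Fin m} {ε : ℝ}

lemma tendsto_inv_mul_partEntropy (hC : IsCorrespondence T) (hT : IsFwdExpansiveWith T ε)
    (hQ : IsTransKernel Q) (hsupp : SupportedBy T Q) [IsProbabilityMeasure μ]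
    (hinv : μ.bind Q = μ) (hR : IsBackwardCondKernel (step2 μ Q) (graph2 T) R)
    (hp : Measurable p) (hfine : ∀ x y, p x = p y → dist x y ≤ ε) :
    Tendsto (fun n : ℕ => (n : ℝ)⁻¹ * partEntropy (markovLaw μ Q (n - 1)) fun x => p ∘ x) atTop
      (𝓝 (∑ i, ∫ x, Real.negMulLog (R x (p ⁻¹' {i})).toReal ∂μ)) :=
  tendsto_inv_mul_of_tendsto_sub
    (a := fun n => partEntropy (markovLaw μ Q n) fun x => p ∘ x)
    (tendsto_partEntropy_succ_sub hC hT hQ hsupp hinv hR hp hfine)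

lemma lintegral_atomEntropy_eq (hC : IsCorrespondence T) (hT : IsFwdExpansiveWith T ε)
    (hQ : IsTransKernel Q) (hsupp : SupportedBy T Q) [IsProbabilityMeasure μ]
    (hinv : μ.bind Q = μ) (hR : IsBackwardCondKernel (step2 μ Q) (graph2 T) R)
    (hp : Measurable p) (hfine : ∀ x y, p x = p y → dist x y ≤ ε) :
    ((∫⁻ x, atomEntropy (R x) ∂μ : ℝ≥0∞) : EReal) =
      ((∑ i, ∫ x, Real.negMulLog (R x (p ⁻¹' {i})).toReal ∂μ : ℝ) : EReal) := by
  have hR1 : ∀ i z, (R z (p ⁻¹' {i})).toReal ≤ 1 := fun i z => by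
    have := hR.2.1 z
    exact measureReal_le_one
  have h0 : ∀ i z, 0 ≤ Real.negMulLog (R z (p ⁻¹' {i})).toReal := fun i z =>
    Real.negMulLog_nonneg ENNReal.toReal_nonneg (hR1 i z)
  have hintg : ∀ i, Integrable (fun z => Real.negMulLog (R z (p ⁻¹' {i})).toReal) μ := fun i => by
    refine Integrable.of_bound (Real.continuous_negMulLog.measurable.comp
      ((Measure.measurable_coe (hp (measurableSet_singleton i))).comp
        hR.1).ennreal_toReal).aestronglyMeasurable 1 (ae_of_all _ fun z => ?_)
    rw [Real.norm_of_nonneg (h0 i z)]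
    have h : 0 ≤ (R z (p ⁻¹' {i})).toReal := ENNReal.toReal_nonneg
    linarith [Real.negMulLog_le_one_sub_self h]
  have hae : ∀ᵐ x ∂μ, atomEntropy (R x) =
      ENNReal.ofReal (∑ i, Real.negMulLog (R x (p ⁻¹' {i})).toReal) := by
    filter_upwards [hR.ae_apply_eq_one hC hQ hsupp hinv] with x hx
    have := hR.2.1 x
    exact atomEntropy_eq_of_injOn hx (hT.injOn_preimage hC hfine x)
  rw [lintegral_congr_ae hae, ← ofReal_integral_eq_lintegral_ofReal
    (integrable_finsetSum _ fun i _ => hintg i)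
    (ae_of_all _ fun x => Finset.sum_nonneg fun i _ => h0 i x),
    integral_finsetSum _ fun i _ => hintg i, EReal.coe_ennreal_ofReal,
    max_eq_left (Finset.sum_nonneg fun i _ => integral_nonneg (h0 i))]

lemma limsup_partEntropy_le (hC : IsCorrespondence T) (hT : IsFwdExpansiveWith T ε)
    (hQ : IsTransKernel Q) (hsupp : SupportedBy T Q) [IsProbabilityMeasure μ]
    (hinv : μ.bind Q = μ) (hR : IsBackwardCondKernel (step2 μ Q) (graph2 T) R)
    (hp : Measurable p) (hfine : ∀ x y, p x = p y → dist x y ≤ ε) {k : ℕ} (f : Fin m → Fin k) :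
    limsup (fun n : ℕ => (n : ℝ)⁻¹ * partEntropy (markovLaw μ Q (n - 1)) fun x => (f ∘ p) ∘ x)
      atTop ≤ ∑ i, ∫ x, Real.negMulLog (R x (p ⁻¹' {i})).toReal ∂μ := by
  have hlim := tendsto_inv_mul_partEntropy hC hT hQ hsupp hinv hR hp hfine
  have hpn := fun n => isProbabilityMeasure_markovLaw (μ := μ) hQ n
  rw [← hlim.limsup_eq]
  refine limsup_le_limsup (Eventually.of_forall fun n => ?_)
    (isCoboundedUnder_le_of_le atTop (x := 0) fun n => ?_) hlim.isBoundedUnder_le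
  · refine mul_le_mul_of_nonneg_left ?_ (by positivity)
    have h : Measurable fun x : Fin (n - 1 + 1) → X => p ∘ x :=
      measurable_pi_lambda _ fun i => hp.comp (measurable_pi_apply i)
    exact partEntropy_comp_le (markovLaw μ Q (n - 1)) (p := fun x => p ∘ x)
      (fun w => h (measurableSet_singleton w)) fun w => f ∘ w
  · exact mul_nonneg (by positivity) (partEntropy_nonneg _ _)

end Rokhlin

/-- **Rokhlin formula for transition probability kernels.** For a forward expansive
correspondence `T`, a transition probability kernel `Q` supported by `T`, a `Q`-invariant
Borel probability measure `μ`, and a backward conditional transition probability kernel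
`R` of `μQ^{[1]}` from `X` to `X` supported on `O₂(T)`, one has
`h_μ(Q) = ∫_X H(R_x) dμ(x)`. -/
theorem rokhlin_kernel
    {X : Type*} [MetricSpace X] [CompactSpace X] [MeasurableSpace X] [BorelSpace X]
    (T : X → Set X) (hT : IsCorrespondence T) (hexp : IsFwdExpansive T)
    (Q : X → Measure X) (hQ : IsTransKernel Q) (hsupp : SupportedBy T Q)
    (μ : Measure X) (hμ : IsProbabilityMeasure μ) (hinv : μ.bind Q = μ)
    (R : X → Measure X) (hR : IsBackwardCondKernel (step2 μ Q) (graph2 T) R) :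
    kernelEntropy μ Q = ((∫⁻ x, atomEntropy (R x) ∂μ : ℝ≥0∞) : EReal) := by
  obtain ⟨ε, hε⟩ := hexp
  have : Nonempty X := nonempty_of_isProbabilityMeasure μ
  obtain ⟨m₀, p₀, hp₀, hfine⟩ := exists_measurable_dist_le_of_eq (X := X) hε.1
  refine le_antisymm (iSup_le fun m => iSup_le fun p => iSup_le fun hp => ?_) ?_
  · let q : X → Fin (m * m₀) := fun x => finProdFinEquiv (p x, p₀ x)
    have hq : Measurable q := (measurable_of_finite finProdFinEquiv).comp (hp.prodMk hp₀)
    have hqfine : ∀ x y, q x = q y → dist x y ≤ ε := fun x y h =>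
      hfine x y (congrArg Prod.snd (finProdFinEquiv.injective h))
    have hpq : p = (fun i => (finProdFinEquiv.symm i).1) ∘ q := by
      funext x
      exact (congrArg Prod.fst (finProdFinEquiv.symm_apply_apply (p x, p₀ x))).symm
    rw [lintegral_atomEntropy_eq hT hε hQ hsupp hinv hR hq hqfine, EReal.coe_le_coe_iff, hpq]
    exact limsup_partEntropy_le hT hε hQ hsupp hinv hR hq hqfine _
  · rw [lintegral_atomEntropy_eq hT hε hQ hsupp hinv hR hp₀ hfine,
      ← (tendsto_inv_mul_partEntropy hT hε hQ hsupp hinv hR hp₀ hfine).limsup_eq]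
    exact le_iSup_of_le m₀ (le_iSup_of_le p₀ (le_iSup_of_le hp₀ le_rfl))

end Corr
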